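/- arXiv:2011.07503 — 3 statements merged into one kernel-verified Lean document; each statement's English description precedes it below -/
import Mathlib

section
/- Fix μ > 0 and ν > 0. The mean constraint has at most one positive solution in λ: if λ₁ > 0 and λ₂ > 0 both satisfy Σ_{y=0}^∞ (y − μ) λ^y/(y!)^ν = 0, then λ₁ = λ₂. Equivalently, the mean of the CMP distribution, λ ↦ Σ_{y=0}^∞ y·λ^y/(y!)^ν / Σ_{y=0}^∞ λ^y/(y!)^ν, is a strictly increasing function of λ on (0,∞). -/
open Filter Real Topology

/-- Normalizing function of the Conway–Maxwell–Poisson distribution: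
`Z(λ, ν) = ∑_{y=0}^∞ λ^y / (y!)^ν`. -/
noncomputable def cmpZ (l ν : ℝ) : ℝ := ∑' y : ℕ, l ^ y / (y.factorial : ℝ) ^ ν

/-- pmf of the CMP distribution: `P(Y = y) = λ^y / ((y!)^ν Z(λ, ν))`. -/
noncomputable def cmpPmf (l ν : ℝ) (y : ℕ) : ℝ :=
  l ^ y / (y.factorial : ℝ) ^ ν / cmpZ l ν

/-- The mean constraint `∑_{y=0}^∞ (y − μ) λ^y / (y!)^ν = 0`. -/
def meanConstraint (μ l ν : ℝ) : Prop :=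
  ∑' y : ℕ, ((y : ℝ) - μ) * l ^ y / (y.factorial : ℝ) ^ ν = 0

lemma summable_pow_div_factorial_rpow {l ν : ℝ} (hl : 0 < l) (hν : 0 < ν) :
    Summable fun y : ℕ => l ^ y / (y.factorial : ℝ) ^ ν := by
  refine summable_of_ratio_test_tendsto_lt_one (l := 0) one_pos
    (Eventually.of_forall fun n => by positivity) ?_
  have hlim : Tendsto (fun n : ℕ => l / ((n : ℝ) + 1) ^ ν) atTop (𝓝 0) :=
    tendsto_const_nhds.div_atTop ((tendsto_rpow_atTop hν).comp
      (tendsto_atTop_add_const_right _ 1 tendsto_natCast_atTop_atTop))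
  refine hlim.congr fun n => ?_
  rw [Real.norm_of_nonneg (by positivity), Real.norm_of_nonneg (by positivity),
    Nat.factorial_succ, Nat.cast_mul, Real.mul_rpow (by positivity) (by positivity), pow_succ]
  push_cast
  field_simp

lemma summable_natCast_mul_pow_div_factorial_rpow {l ν : ℝ} (hl : 0 < l) (hν : 0 < ν) :
    Summable fun y : ℕ => (y : ℝ) * l ^ y / (y.factorial : ℝ) ^ ν := by
  refine (summable_pow_div_factorial_rpow (mul_pos two_pos hl) hν).of_nonneg_of_le
    (fun y => by positivity) fun y => ?_
  rw [mul_pow]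
  gcongr
  exact_mod_cast Nat.lt_two_pow_self.le

lemma hasSum_natCast_sub_mul_pow_div_factorial_rpow (m : ℝ) {l ν : ℝ} (hl : 0 < l)
    (hν : 0 < ν) :
    HasSum (fun y : ℕ => ((y : ℝ) - m) * l ^ y / (y.factorial : ℝ) ^ ν)
      ((∑' y : ℕ, (y : ℝ) * l ^ y / (y.factorial : ℝ) ^ ν) - m * cmpZ l ν) := by
  have hsum := (summable_natCast_mul_pow_div_factorial_rpow hl hν).hasSum.sub
    ((summable_pow_div_factorial_rpow hl hν).hasSum.mul_left m)
  have hterm : (fun y : ℕ => ((y : ℝ) - m) * l ^ y / (y.factorial : ℝ) ^ ν) = fun y : ℕ =>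
      (y : ℝ) * l ^ y / (y.factorial : ℝ) ^ ν - m * (l ^ y / (y.factorial : ℝ) ^ ν) := by
    ext y
    ring
  rw [hterm]
  exact hsum

lemma cmpZ_pos {l ν : ℝ} (hl : 0 < l) (hν : 0 < ν) : 0 < cmpZ l ν :=
  (summable_pow_div_factorial_rpow hl hν).tsum_pos (fun y => by positivity) 0 (by positivity)

lemma sub_mul_rpow_lt_sub_mul_rpow {r x m : ℝ} (hr : 1 < r) (hx : x ≠ m) :
    (x - m) * r ^ m < (x - m) * r ^ x := by
  rcases hx.lt_or_gt with h | h
  · exact mul_lt_mul_of_neg_left (Real.rpow_lt_rpow_of_exponent_lt hr h) (sub_neg.2 h)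
  · exact mul_lt_mul_of_pos_left (Real.rpow_lt_rpow_of_exponent_lt hr h) (sub_pos.2 h)

/-- If the mean constraint holds at `l₁`, then its left-hand side is positive at every
larger parameter. -/
lemma meanConstraint.tsum_pos {m l₁ l₂ ν : ℝ} (hν : 0 < ν) (h₁ : 0 < l₁) (h : l₁ < l₂)
    (hm : meanConstraint m l₁ ν) :
    0 < ∑' y : ℕ, ((y : ℝ) - m) * l₂ ^ y / (y.factorial : ℝ) ^ ν := by
  have hs₁ := (hasSum_natCast_sub_mul_pow_div_factorial_rpow m h₁ hν).summable
  have hs₂ := (hasSum_natCast_sub_mul_pow_div_factorial_rpow m (h₁.trans h) hν).summable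
  have hr : 1 < l₂ / l₁ := (one_lt_div h₁).2 h
  have hterm (y : ℕ) : ((y : ℝ) - m) * l₂ ^ y / (y.factorial : ℝ) ^ ν =
      ((y : ℝ) - m) * (l₂ / l₁) ^ (y : ℝ) * (l₁ ^ y / (y.factorial : ℝ) ^ ν) := by
    rw [Real.rpow_natCast, div_pow]
    field_simp
  have hscale (y : ℕ) : (l₂ / l₁) ^ m * (((y : ℝ) - m) * l₁ ^ y / (y.factorial : ℝ) ^ ν) =
      ((y : ℝ) - m) * (l₂ / l₁) ^ m * (l₁ ^ y / (y.factorial : ℝ) ^ ν) := by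
    ring
  have hlt (y : ℕ) (hy : (y : ℝ) ≠ m) :
      (l₂ / l₁) ^ m * (((y : ℝ) - m) * l₁ ^ y / (y.factorial : ℝ) ^ ν) <
        ((y : ℝ) - m) * l₂ ^ y / (y.factorial : ℝ) ^ ν := by
    rw [hterm, hscale]
    exact mul_lt_mul_of_pos_right (sub_mul_rpow_lt_sub_mul_rpow hr hy) (by positivity)
  have hle (y : ℕ) : (l₂ / l₁) ^ m * (((y : ℝ) - m) * l₁ ^ y / (y.factorial : ℝ) ^ ν) ≤
      ((y : ℝ) - m) * l₂ ^ y / (y.factorial : ℝ) ^ ν := by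
    by_cases hy : (y : ℝ) = m
    · simp [hy]
    · exact (hlt y hy).le
  obtain ⟨i, hi⟩ : ∃ i : ℕ, (i : ℝ) ≠ m := by
    by_cases h0 : m = 0
    · exact ⟨1, by simp [h0]⟩
    · exact ⟨0, by simpa using Ne.symm h0⟩
  calc
    0 = ∑' y : ℕ, (l₂ / l₁) ^ m * (((y : ℝ) - m) * l₁ ^ y / (y.factorial : ℝ) ^ ν) := by
      rw [tsum_mul_left, show ∑' y : ℕ, ((y : ℝ) - m) * l₁ ^ y / (y.factorial : ℝ) ^ ν = 0
        from hm, mul_zero]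
    _ < _ := Summable.tsum_lt_tsum hle (hlt i hi) (hs₁.mul_left _) hs₂

/-- The mean constraint has at most one positive solution in `λ`; equivalently, the
CMP mean is a strictly increasing function of `λ` on `(0, ∞)`. -/
theorem stmt10 (μ ν : ℝ) (hμ : 0 < μ) (hν : 0 < ν) :
    (∀ l₁ l₂ : ℝ, 0 < l₁ → 0 < l₂ →
      meanConstraint μ l₁ ν → meanConstraint μ l₂ ν → l₁ = l₂) ∧
    StrictMonoOn
      (fun l : ℝ => (∑' y : ℕ, (y : ℝ) * l ^ y / (y.factorial : ℝ) ^ ν) / cmpZ l ν)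
      (Set.Ioi 0) := by
  refine ⟨fun l₁ l₂ h₁ h₂ hm₁ hm₂ => ?_, fun l₁ h₁ l₂ h₂ h => ?_⟩
  · rcases lt_trichotomy l₁ l₂ with h | h | h
    · exact absurd hm₂ (hm₁.tsum_pos hν h₁ h).ne'
    · exact h
    · exact absurd hm₁ (hm₂.tsum_pos hν h₂ h).ne'
  · rw [Set.mem_Ioi] at h₁ h₂
    set m := (∑' y : ℕ, (y : ℝ) * l₁ ^ y / (y.factorial : ℝ) ^ ν) / cmpZ l₁ ν with hm
    have hm₁ : meanConstraint m l₁ ν := by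
      rw [meanConstraint, (hasSum_natCast_sub_mul_pow_div_factorial_rpow m h₁ hν).tsum_eq, hm,
        div_mul_cancel₀ _ (cmpZ_pos h₁ hν).ne', sub_self]
    have hpos := hm₁.tsum_pos hν h₁ h
    rw [(hasSum_natCast_sub_mul_pow_div_factorial_rpow m h₂ hν).tsum_eq, sub_pos] at hpos
    exact (lt_div_iff₀ (cmpZ_pos h₂ hν)).2 hpos
end

section
/- Fix a non-integer real μ > 0, set Δ = μ − ⌊μ⌋ ∈ (0,1), and define m_ν(λ) = Σ_{y=0}^∞ (y − μ) λ^y/(y!)^ν. Then m_ν((1 − Δ)^{−1}·⌈μ⌉^ν) > 0 for all sufficiently large ν. -/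
open Filter Real Topology

/-- `m_ν(λ) = ∑_{y=0}^∞ (y − μ) λ^y / (y!)^ν`. -/
noncomputable def mFun (μ l ν : ℝ) : ℝ :=
  ∑' y : ℕ, ((y : ℝ) - μ) * l ^ y / (y.factorial : ℝ) ^ ν

/-- The series defining `mFun μ l ν` converges when `1 ≤ ν`. -/
theorem summable_mFun (μ l ν : ℝ) (hν : 1 ≤ ν) :
    Summable fun y : ℕ => ((y : ℝ) - μ) * l ^ y / (y.factorial : ℝ) ^ ν := by
  refine Summable.of_norm_bounded
    ((Real.summable_pow_div_factorial (2 * |l|)).mul_left (1 + |μ|)) fun y => ?_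
  have hf : (1 : ℝ) ≤ y.factorial := by exact_mod_cast y.factorial_pos
  have hle : (y.factorial : ℝ) ≤ (y.factorial : ℝ) ^ ν := by
    simpa using Real.rpow_le_rpow_of_exponent_le hf hν
  have h2 : (y : ℝ) ≤ 2 ^ y := by exact_mod_cast y.lt_two_pow_self.le
  have h1 : (1 : ℝ) ≤ 2 ^ y := one_le_pow₀ (by norm_num)
  have habs : |(y : ℝ) - μ| ≤ (1 + |μ|) * 2 ^ y := by
    have := abs_sub (y : ℝ) μ
    rw [Nat.abs_cast] at this
    nlinarith [abs_nonneg μ]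
  rw [norm_div, norm_mul, norm_pow, Real.norm_eq_abs, Real.norm_eq_abs, Real.norm_eq_abs,
    abs_of_nonneg (by positivity : (0 : ℝ) ≤ (y.factorial : ℝ) ^ ν), ← mul_div_assoc, mul_pow,
    ← mul_assoc]
  gcongr

/-- `(n + 1) ^ y / y!` is smaller at `y < n` than at `n`. -/
theorem pow_div_factorial_lt_of_lt {n y : ℕ} (h : y < n) :
    ((n : ℝ) + 1) ^ y / y.factorial < ((n : ℝ) + 1) ^ n / n.factorial := by
  have step (k : ℕ) (hk : k < n) :
      ((n : ℝ) + 1) ^ k / k.factorial < ((n : ℝ) + 1) ^ (k + 1) / (k + 1).factorial := by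
    have hkn : (k : ℝ) + 1 < n + 1 := by exact_mod_cast Nat.succ_lt_succ hk
    rw [Nat.factorial_succ, pow_succ, Nat.cast_mul, mul_comm ((k + 1 : ℕ) : ℝ),
      mul_div_mul_comm, Nat.cast_succ]
    exact lt_mul_of_one_lt_right (by positivity) ((one_lt_div (by positivity)).2 hkn)
  have key (m : ℕ) (hm : y < m) (hmn : m ≤ n) :
      ((n : ℝ) + 1) ^ y / y.factorial < ((n : ℝ) + 1) ^ m / m.factorial := by
    induction m, hm using Nat.le_induction with
    | base => exact step y (by omega)
    | succ k hk ih => exact (ih (by omega)).trans (step k (by omega))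
  exact key n h le_rfl

/-- For non-integer `μ > 0` with `Δ = μ − ⌊μ⌋`, `m_ν((1−Δ)⁻¹⌈μ⌉^ν) > 0` for all
sufficiently large `ν`. -/
theorem stmt14 (μ : ℝ) (hμ : 0 < μ) (hni : ¬ ∃ n : ℤ, (n : ℝ) = μ) :
    ∀ᶠ ν in (atTop : Filter ℝ),
      0 < mFun μ ((1 - (μ - ⌊μ⌋₊))⁻¹ * (⌈μ⌉₊ : ℝ) ^ ν) ν := by
  have hne : (⌊μ⌋₊ : ℝ) ≠ μ := fun h => hni ⟨⌊μ⌋₊, by exact_mod_cast h⟩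
  have hlo : (⌊μ⌋₊ : ℝ) < μ := lt_of_le_of_ne (Nat.floor_le hμ.le) hne
  have hhi : μ < ⌊μ⌋₊ + 1 := Nat.lt_floor_add_one μ
  have hceil : ⌈μ⌉₊ = ⌊μ⌋₊ + 1 :=
    (Nat.ceil_eq_iff (by omega)).2 ⟨by simpa using hlo, by push_cast; exact hhi.le⟩
  rw [hceil]
  generalize ⌊μ⌋₊ = n at *
  set q : ℝ := (1 - (μ - n))⁻¹
  have hδ : 0 < 1 - (μ - n) := by linarith
  have hq0 : 0 < q := inv_pos.2 hδ
  set b : ℕ → ℝ := fun y => ((n : ℝ) + 1) ^ y / y.factorial with hb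
  have hb0 (y : ℕ) : 0 < b y := by positivity
  have hbn : b (n + 1) = b n := by
    simp only [hb, Nat.factorial_succ]
    push_cast
    field_simp
    ring
  have hterm (y : ℕ) (ν : ℝ) :
      ((y : ℝ) - μ) * (q * ((n + 1 : ℕ) : ℝ) ^ ν) ^ y / (y.factorial : ℝ) ^ ν
        = (b n) ^ ν * (((y : ℝ) - μ) * q ^ y * (b y / b n) ^ ν) := by
    have hby : (b y) ^ ν = (((n : ℝ) + 1) ^ ν) ^ y / (y.factorial : ℝ) ^ ν := by
      rw [Real.div_rpow (by positivity) (by positivity), Real.rpow_pow_comm (by positivity)]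
    have := Real.rpow_pos_of_pos (hb0 n) ν
    rw [Real.div_rpow (hb0 y).le (hb0 n).le, hby, mul_pow]
    push_cast
    field_simp
  have hlim : Tendsto (fun ν : ℝ => ∑ y ∈ Finset.range (n + 2),
      ((y : ℝ) - μ) * q ^ y * (b y / b n) ^ ν) atTop (𝓝 (q ^ n * (1 - (μ - n)))) := by
    have hsmall : Tendsto (fun ν : ℝ => ∑ y ∈ Finset.range n,
        ((y : ℝ) - μ) * q ^ y * (b y / b n) ^ ν) atTop (𝓝 0) := by
      rw [← Finset.sum_const_zero (s := Finset.range n)]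
      refine tendsto_finsetSum _ fun y hy => ?_
      have hlt : b y / b n < 1 :=
        (div_lt_one (hb0 n)).2 (pow_div_factorial_lt_of_lt (Finset.mem_range.1 hy))
      have hpos : 0 < b y / b n := div_pos (hb0 y) (hb0 n)
      simpa using (tendsto_rpow_atTop_of_base_lt_one _ (by linarith) hlt).const_mul
        (((y : ℝ) - μ) * q ^ y)
    have hval : q ^ n * (1 - (μ - n))
        = 0 + ((n : ℝ) - μ) * q ^ n + (((n + 1 : ℕ) : ℝ) - μ) * q ^ (n + 1) := by
      have : (1 - (μ - n)) * q = 1 := mul_inv_cancel₀ hδ.ne'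
      push_cast
      linear_combination -q ^ n * this
    rw [hval]
    simp only [Finset.sum_range_succ, hbn, div_self (hb0 n).ne', Real.one_rpow, mul_one]
    exact (hsmall.add_const _).add_const _
  filter_upwards [hlim.eventually_const_lt (by positivity), eventually_ge_atTop 1] with ν hν hν1
  have hsum := summable_mFun μ (q * ((n + 1 : ℕ) : ℝ) ^ ν) ν hν1
  refine lt_of_lt_of_le ?_ (hsum.sum_le_tsum (Finset.range (n + 2)) fun y hy => ?_)
  · simp only [hterm, ← Finset.mul_sum]
    exact mul_pos (Real.rpow_pos_of_pos (hb0 n) ν) hν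
  · have hy' : (n : ℝ) + 1 ≤ y := by
      have : n + 1 ≤ y := by simp only [Finset.mem_range] at hy; omega
      exact_mod_cast this
    have : 0 ≤ (y : ℝ) - μ := by linarith
    positivity
end

section
/- Let μ be a positive integer. Suppose for each ν > 0, λ(ν) > 0 satisfies the mean constraint Σ_{y=0}^∞ (y − μ) λ(ν)^y/(y!)^ν = 0. Then the ratios of successive CMP probabilities satisfy P_ν(Y = μ − 1)/P_ν(Y = μ) = μ^ν/λ(ν) → 0 and P_ν(Y = μ)/P_ν(Y = μ + 1) = (μ+1)^ν/λ(ν) → ∞ as ν → ∞. -/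
open Filter Real Topology

/-- The unnormalized CMP weight `λ^y / (y!)^ν`. -/
noncomputable def cmpWeight (l ν : ℝ) (y : ℕ) : ℝ := l ^ y / (y.factorial : ℝ) ^ ν

lemma cmpWeight_pos {l : ℝ} (hl : 0 < l) (ν : ℝ) (y : ℕ) : 0 < cmpWeight l ν y := by
  have : (0 : ℝ) < y.factorial := by exact_mod_cast y.factorial_pos
  unfold cmpWeight
  positivity

lemma cmpWeight_succ (l ν : ℝ) (y : ℕ) :
    cmpWeight l ν (y + 1) = l / ((y : ℝ) + 1) ^ ν * cmpWeight l ν y := by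
  have h : (0 : ℝ) < y.factorial := by exact_mod_cast y.factorial_pos
  unfold cmpWeight
  rw [Nat.factorial_succ, Nat.cast_mul, Real.mul_rpow (by positivity) h.le, pow_succ]
  push_cast
  rw [div_mul_div_comm, mul_comm l]

lemma summable_cmpWeight {l ν : ℝ} (hl : 0 < l) (hν : 0 < ν) : Summable (cmpWeight l ν) := by
  refine summable_of_ratio_test_tendsto_lt_one (l := 0) one_pos
    (Eventually.of_forall fun y => (cmpWeight_pos hl ν y).ne') ?_
  have h : Tendsto (fun y : ℕ => l / ((y : ℝ) + 1) ^ ν) atTop (𝓝 0) :=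
    Tendsto.const_div_atTop ((tendsto_rpow_atTop hν).comp
      (tendsto_atTop_add_const_right _ 1 tendsto_natCast_atTop_atTop)) l
  refine h.congr fun y => ?_
  have hy := cmpWeight_pos hl ν y
  rw [Real.norm_of_nonneg (cmpWeight_pos hl ν _).le, Real.norm_of_nonneg hy.le, cmpWeight_succ,
    mul_div_cancel_right₀ _ hy.ne']

lemma summable_sub_mul_cmpWeight {l ν : ℝ} (hl : 0 < l) (hν : 0 < ν) (c : ℝ) :
    Summable fun y : ℕ => ((y : ℝ) - c) * cmpWeight l ν y := by
  have h2 : Summable fun y : ℕ => (1 + |c|) * cmpWeight (2 * l) ν y :=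
    (summable_cmpWeight (by positivity) hν).mul_left _
  refine h2.of_norm_bounded fun y => ?_
  have hw := cmpWeight_pos hl ν y
  have hscale : cmpWeight (2 * l) ν y = 2 ^ y * cmpWeight l ν y := by
    unfold cmpWeight
    rw [mul_pow, mul_div_assoc]
  have hy : (y : ℝ) ≤ 2 ^ y := by exact_mod_cast Nat.lt_two_pow_self.le
  have h1 : (1 : ℝ) ≤ 2 ^ y := one_le_pow₀ one_le_two
  rw [norm_mul, Real.norm_of_nonneg hw.le, hscale, ← mul_assoc]
  refine mul_le_mul_of_nonneg_right ?_ hw.le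
  calc ‖(y : ℝ) - c‖ ≤ ‖(y : ℝ)‖ + ‖c‖ := norm_sub_le _ _
    _ = y + |c| := by rw [Real.norm_of_nonneg y.cast_nonneg, Real.norm_eq_abs]
    _ ≤ (1 + |c|) * 2 ^ y := by nlinarith [abs_nonneg c]

lemma summable_mul_cmpWeight_add {l ν : ℝ} (hl : 0 < l) (hν : 0 < ν) (μ : ℕ) :
    Summable fun k : ℕ => (k : ℝ) * cmpWeight l ν (k + μ) := by
  simpa using (summable_nat_add_iff μ).2 (summable_sub_mul_cmpWeight hl hν μ)

/-- The mean constraint balances the deviations below and above the mean. -/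
lemma meanConstraint.sum_eq_tsum {l ν : ℝ} {μ : ℕ} (h : meanConstraint μ l ν) (hl : 0 < l)
    (hν : 0 < ν) : ∑ y ∈ Finset.range μ, ((μ : ℝ) - y) * cmpWeight l ν y =
      ∑' k : ℕ, (k : ℝ) * cmpWeight l ν (k + μ) := by
  have hsplit := (summable_sub_mul_cmpWeight hl hν μ).sum_add_tsum_nat_add μ
  have hzero : ∑' y : ℕ, ((y : ℝ) - μ) * cmpWeight l ν y = 0 := by
    simpa only [meanConstraint, cmpWeight, mul_div_assoc] using h
  have hneg : ∑ y ∈ Finset.range μ, ((μ : ℝ) - y) * cmpWeight l ν y =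
      -∑ y ∈ Finset.range μ, ((y : ℝ) - μ) * cmpWeight l ν y := by
    rw [← Finset.sum_neg_distrib]
    exact Finset.sum_congr rfl fun y _ => by ring
  simp only [Nat.cast_add, add_sub_cancel_right] at hsplit
  linarith

lemma cmpWeight_le_sum_below {l : ℝ} (hl : 0 < l) (ν : ℝ) (m : ℕ) :
    cmpWeight l ν m ≤ ∑ y ∈ Finset.range (m + 1), (((m + 1 : ℕ) : ℝ) - y) * cmpWeight l ν y := by
  have h := Finset.single_le_sum (f := fun y : ℕ => (((m + 1 : ℕ) : ℝ) - y) * cmpWeight l ν y)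
    (fun y hy => mul_nonneg (sub_nonneg.2 (by exact_mod_cast (Finset.mem_range.1 hy).le))
      (cmpWeight_pos hl ν y).le) (Finset.self_mem_range_succ m)
  simpa using h

lemma cmpWeight_le_tsum_above {l ν : ℝ} (hl : 0 < l) (hν : 0 < ν) (μ : ℕ) :
    cmpWeight l ν (μ + 1) ≤ ∑' k : ℕ, (k : ℝ) * cmpWeight l ν (k + μ) := by
  have h := (summable_mul_cmpWeight_add hl hν μ).le_tsum 1
    fun k _ => mul_nonneg k.cast_nonneg (cmpWeight_pos hl ν _).le
  simpa [add_comm] using h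

lemma sum_below_le {l ν : ℝ} (hl : 0 < l) (hν : 0 < ν) {m : ℕ} (hm : ((m : ℝ) + 1) ^ ν ≤ l) :
    ∑ y ∈ Finset.range (m + 1), (((m + 1 : ℕ) : ℝ) - y) * cmpWeight l ν y ≤
      ((m : ℝ) + 1) ^ 2 * cmpWeight l ν m := by
  have hmono : ∀ y ≤ m, cmpWeight l ν y ≤ cmpWeight l ν m := fun y hy => by
    refine Nat.decreasingInduction' (P := fun y => cmpWeight l ν y ≤ cmpWeight l ν m)
      (fun k hk _ ih => le_trans ?_ ih) hy le_rfl
    rw [cmpWeight_succ]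
    refine le_mul_of_one_le_left (cmpWeight_pos hl ν k).le ((one_le_div (by positivity)).2 ?_)
    have hkm : (k : ℝ) ≤ m := by exact_mod_cast hk.le
    exact (Real.rpow_le_rpow (by positivity) (by linarith) hν.le).trans hm
  calc _ ≤ ∑ _y ∈ Finset.range (m + 1), ((m : ℝ) + 1) * cmpWeight l ν m := by
        refine Finset.sum_le_sum fun y hy => ?_
        have hy' : 0 ≤ (y : ℝ) := y.cast_nonneg
        push_cast
        exact mul_le_mul (by linarith) (hmono y (Nat.lt_succ_iff.1 (Finset.mem_range.1 hy)))
          (cmpWeight_pos hl ν y).le (by positivity)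
    _ = _ := by
        rw [Finset.sum_const, Finset.card_range, nsmul_eq_mul]
        push_cast
        ring

lemma tsum_above_le {l ν : ℝ} (hl : 0 < l) (hν : 0 < ν) {μ : ℕ}
    (hb : l / ((μ : ℝ) + 1) ^ ν < 1) :
    ∑' k : ℕ, (k : ℝ) * cmpWeight l ν (k + μ) ≤
      l / ((μ : ℝ) + 1) ^ ν / (1 - l / ((μ : ℝ) + 1) ^ ν) ^ 2 * cmpWeight l ν μ := by
  set b := l / ((μ : ℝ) + 1) ^ ν with hbdef
  have hb0 : 0 < b := by positivity
  have hbn : ‖b‖ < 1 := by rwa [Real.norm_of_nonneg hb0.le]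
  have hgeom : ∀ k : ℕ, cmpWeight l ν (k + μ) ≤ b ^ k * cmpWeight l ν μ := by
    intro k
    induction k with
    | zero => simp
    | succ k ih =>
      rw [add_right_comm, cmpWeight_succ, pow_succ', mul_assoc]
      refine mul_le_mul ?_ ih (cmpWeight_pos hl ν _).le hb0.le
      have hk : 0 ≤ (k : ℝ) := k.cast_nonneg
      refine div_le_div_of_nonneg_left hl.le (by positivity)
        (Real.rpow_le_rpow (by positivity) ?_ hν.le)
      push_cast
      linarith
  have hs := (hasSum_coe_mul_geometric_of_norm_lt_one hbn).mul_right (cmpWeight l ν μ)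
  rw [← hs.tsum_eq]
  refine (summable_mul_cmpWeight_add hl hν μ).tsum_le_tsum (fun k => ?_) hs.summable
  rw [mul_assoc]
  exact mul_le_mul_of_nonneg_left (hgeom k) k.cast_nonneg

lemma cmpPmf_div_cmpPmf_succ {l ν : ℝ} (hl : 0 < l) (hν : 0 < ν) (y : ℕ) :
    cmpPmf l ν y / cmpPmf l ν (y + 1) = ((y : ℝ) + 1) ^ ν / l := by
  have hZ : 0 < cmpZ l ν :=
    (summable_cmpWeight hl hν).tsum_pos (fun y => (cmpWeight_pos hl ν y).le) 0
      (cmpWeight_pos hl ν 0)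
  change cmpWeight l ν y / cmpZ l ν / (cmpWeight l ν (y + 1) / cmpZ l ν) = _
  have hy := cmpWeight_pos hl ν y
  have hr : 0 < ((y : ℝ) + 1) ^ ν := by positivity
  rw [div_div_div_cancel_right₀ hZ.ne', cmpWeight_succ]
  field_simp

/-- If the mean is `m + 1`, the ratio `P(Y = m + 2) / P(Y = m + 1)` is controlled by
`((m + 1) / (m + 2)) ^ ν`. -/
lemma upper_ratio_sq_le {l ν : ℝ} {m : ℕ} (hl : 0 < l) (hν : 0 < ν)
    (h : meanConstraint ((m + 1 : ℕ) : ℝ) l ν) :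
    (l / ((m : ℝ) + 2) ^ ν) ^ 2 ≤ ((m : ℝ) + 1) ^ 2 * (((m : ℝ) + 1) / (m + 2)) ^ ν := by
  have hp : 0 < ((m : ℝ) + 1) ^ ν := by positivity
  have hq : 0 < ((m : ℝ) + 2) ^ ν := by positivity
  have hpq : ((m : ℝ) + 1) ^ ν ≤ ((m : ℝ) + 2) ^ ν :=
    Real.rpow_le_rpow (by positivity) (by linarith) hν.le
  have hone : (1 : ℝ) ≤ ((m : ℝ) + 1) ^ 2 := one_le_pow₀ (by simp)
  rw [Real.div_rpow (by positivity) (by positivity)]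
  rcases le_total (((m : ℝ) + 1) ^ ν) l with hle | hle
  · have hw := cmpWeight_pos hl ν m
    have hchain := (cmpWeight_le_tsum_above hl hν (m + 1)).trans
      ((h.sum_eq_tsum hl hν).symm.le.trans (sum_below_le hl hν hle))
    rw [cmpWeight_succ, cmpWeight_succ, ← mul_assoc] at hchain
    have hmul := le_of_mul_le_mul_right hchain hw
    push_cast at hmul
    rw [show (m : ℝ) + 1 + 1 = m + 2 by ring] at hmul
    calc (l / ((m : ℝ) + 2) ^ ν) ^ 2
        = l / ((m : ℝ) + 2) ^ ν * (l / ((m : ℝ) + 1) ^ ν) *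
            (((m : ℝ) + 1) ^ ν / ((m : ℝ) + 2) ^ ν) := by field_simp
      _ ≤ _ := mul_le_mul_of_nonneg_right hmul (by positivity)
  · have hb : l / ((m : ℝ) + 2) ^ ν ≤ ((m : ℝ) + 1) ^ ν / ((m : ℝ) + 2) ^ ν := by gcongr
    have hb0 : 0 < l / ((m : ℝ) + 2) ^ ν := by positivity
    have hr : ((m : ℝ) + 1) ^ ν / ((m : ℝ) + 2) ^ ν ≤ 1 := (div_le_one hq).2 hpq
    nlinarith

lemma lower_ratio_le {l ν : ℝ} {m : ℕ} (hl : 0 < l) (hν : 0 < ν)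
    (h : meanConstraint ((m + 1 : ℕ) : ℝ) l ν) (hb : l / ((m : ℝ) + 2) ^ ν < 1) :
    ((m : ℝ) + 1) ^ ν / l ≤
      l / ((m : ℝ) + 2) ^ ν / (1 - l / ((m : ℝ) + 2) ^ ν) ^ 2 := by
  have hp : 0 < ((m : ℝ) + 1) ^ ν := by positivity
  have hcast : ((m + 1 : ℕ) : ℝ) + 1 = m + 2 := by push_cast; ring
  have hchain := (cmpWeight_le_sum_below hl ν m).trans
    ((h.sum_eq_tsum hl hν).le.trans (tsum_above_le hl hν (by rwa [hcast])))
  rw [cmpWeight_succ, ← mul_assoc, hcast] at hchain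
  have hmul := (le_mul_iff_one_le_left (cmpWeight_pos hl ν m)).1 hchain
  rwa [← mul_div_assoc, one_le_div hp, ← div_le_iff₀ hl] at hmul

/-- For a positive integer mean `μ`, the successive probability ratios satisfy
`P_ν(Y = μ−1)/P_ν(Y = μ) = μ^ν/λ(ν) → 0` and
`P_ν(Y = μ)/P_ν(Y = μ+1) = (μ+1)^ν/λ(ν) → ∞` as `ν → ∞`. -/
theorem stmt18 (μ : ℕ) (hμ : 1 ≤ μ) (lam : ℝ → ℝ)
    (hlam : ∀ ν : ℝ, 0 < ν → 0 < lam ν ∧ meanConstraint (μ : ℝ) (lam ν) ν) :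
    (∀ ν : ℝ, 0 < ν →
      cmpPmf (lam ν) ν (μ - 1) / cmpPmf (lam ν) ν μ = (μ : ℝ) ^ ν / lam ν) ∧
    Tendsto (fun ν : ℝ => (μ : ℝ) ^ ν / lam ν) atTop (𝓝 0) ∧
    (∀ ν : ℝ, 0 < ν →
      cmpPmf (lam ν) ν μ / cmpPmf (lam ν) ν (μ + 1) = ((μ : ℝ) + 1) ^ ν / lam ν) ∧
    Tendsto (fun ν : ℝ => ((μ : ℝ) + 1) ^ ν / lam ν) atTop atTop := by
  obtain ⟨m, rfl⟩ : ∃ m, μ = m + 1 := ⟨μ - 1, by omega⟩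
  have hb : Tendsto (fun ν : ℝ => lam ν / ((m : ℝ) + 2) ^ ν) atTop (𝓝 0) := by
    have hr : Tendsto (fun ν : ℝ => ((m : ℝ) + 1) ^ 2 * (((m : ℝ) + 1) / (m + 2)) ^ ν) atTop
        (𝓝 0) := by
      have h0 : (0 : ℝ) < ((m : ℝ) + 1) / (m + 2) := by positivity
      have h1 : ((m : ℝ) + 1) / (m + 2) < 1 := (div_lt_one (by positivity)).2 (by linarith)
      simpa using (tendsto_rpow_atTop_of_base_lt_one _ (by linarith) h1).const_mul
        (((m : ℝ) + 1) ^ 2)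
    have hsq : Tendsto (fun ν : ℝ => (lam ν / ((m : ℝ) + 2) ^ ν) ^ 2) atTop (𝓝 0) := by
      refine squeeze_zero' (Eventually.of_forall fun ν => sq_nonneg _) ?_ hr
      filter_upwards [eventually_gt_atTop 0] with ν hν
      exact upper_ratio_sq_le (hlam ν hν).1 hν (hlam ν hν).2
    have hsqrt := hsq.sqrt
    rw [Real.sqrt_zero] at hsqrt
    refine hsqrt.congr' ?_
    filter_upwards [eventually_gt_atTop 0] with ν hν
    have := (hlam ν hν).1
    exact Real.sqrt_sq (by positivity)
  refine ⟨fun ν hν => ?_, ?_, fun ν hν => cmpPmf_div_cmpPmf_succ (hlam ν hν).1 hν _, ?_⟩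
  · simpa using cmpPmf_div_cmpPmf_succ (hlam ν hν).1 hν m
  · have hlim : Tendsto (fun ν : ℝ => lam ν / ((m : ℝ) + 2) ^ ν /
        (1 - lam ν / ((m : ℝ) + 2) ^ ν) ^ 2) atTop (𝓝 0) := by
      have hdiv := hb.div ((tendsto_const_nhds.sub hb).pow 2)
        (by norm_num : ((1 : ℝ) - 0) ^ 2 ≠ 0)
      rwa [zero_div] at hdiv
    push_cast
    refine squeeze_zero' ?_ ?_ hlim
    · filter_upwards [eventually_gt_atTop 0] with ν hν
      have := (hlam ν hν).1
      positivity
    · filter_upwards [eventually_gt_atTop 0, hb.eventually_lt_const one_pos] with ν hν hν1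
      exact lower_ratio_le (hlam ν hν).1 hν (hlam ν hν).2 hν1
  · have hpos : ∀ᶠ ν : ℝ in atTop, 0 < lam ν / ((m : ℝ) + 2) ^ ν := by
      filter_upwards [eventually_gt_atTop 0] with ν hν
      have := (hlam ν hν).1
      positivity
    have hinv := (tendsto_nhdsWithin_iff.2 ⟨hb, hpos⟩).inv_tendsto_nhdsGT_zero
    refine hinv.congr fun ν => ?_
    rw [Pi.inv_apply, inv_div]
    push_cast
    rw [show (m : ℝ) + 1 + 1 = m + 2 by ring]
end
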